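/- Let N ≥ 3 be an integer. (i) The family of primitive scales {tan(π/N)/tan(kπ/N) : k an integer with 1 ≤ k < N/2 and gcd(k, N) = 1} is linearly independent over ℚ as a family of real numbers. (ii) For every integer j with 1 ≤ j < N/2, the scale tan(π/N)/tan(jπ/N) lies in the ℚ-linear span of the primitive scales. Hence the primitive scales form a ℚ-basis of the ℚ-span of all the scales, and the number of ℚ-linearly independent scales is φ(N)/2, where φ is the Euler totient function. -/

import Mathlib

open Filter Topology Real

lemma rpow_neg_sub_rpow_neg_le {n x y s : ℝ} (hn : 1 ≤ n) (hx : n ≤ x) (hxy : x ≤ y)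
    (hyx : y ≤ x + 1) (hs : 1 ≤ s) (hs' : s ≤ 2) :
    |x ^ (-s) - y ^ (-s)| ≤ 2 / n ^ 2 := by
  have hx0 : 0 < x := by linarith
  have hy0 : 0 < y := by linarith
  have hle : y ^ (-s) ≤ x ^ (-s) := rpow_le_rpow_of_nonpos hx0 hxy (by linarith)
  rw [abs_of_nonneg (sub_nonneg.2 hle)]
  have hfac : y ^ (-s) = x ^ (-s) * (x / y) ^ s := by
    rw [div_rpow hx0.le hy0.le, rpow_neg hx0.le, rpow_neg hy0.le]
    have := (rpow_pos_of_pos hx0 s).ne'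
    field_simp
  have hsq : (x / y) ^ (2 : ℝ) ≤ (x / y) ^ s :=
    rpow_le_rpow_of_exponent_ge (by positivity) ((div_le_one hy0).2 hxy) hs'
  have hinv : x ^ (-s) ≤ x⁻¹ := by
    rw [← rpow_neg_one]
    exact rpow_le_rpow_of_exponent_le (by linarith) (by linarith)
  have hquad : 1 - (x / y) ^ s ≤ 2 / x := by
    rw [rpow_two] at hsq
    have h1 : 1 - x / y ≤ 1 / x := by
      rw [← sub_nonneg]
      have : 1 / x - (1 - x / y) = (y - x * (y - x)) / (x * y) := by field_simp
      rw [this]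
      apply div_nonneg _ (by positivity)
      nlinarith
    have h2 : 1 - (x / y) ^ 2 ≤ 2 * (1 - x / y) := by nlinarith [sq_nonneg (1 - x / y)]
    calc 1 - (x / y) ^ s ≤ 2 * (1 / x) := by linarith
      _ = 2 / x := by ring
  calc x ^ (-s) - y ^ (-s) = x ^ (-s) * (1 - (x / y) ^ s) := by rw [hfac]; ring
    _ ≤ x⁻¹ * (2 / x) := mul_le_mul hinv hquad
        (sub_nonneg.2 (rpow_le_one (by positivity) ((div_le_one hy0).2 hxy) (by linarith)))
        (by positivity)
    _ = 2 / x ^ 2 := by field_simp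
    _ ≤ 2 / n ^ 2 := by gcongr

lemma tsum_one_div_sub_one_div_eq_cot {a : ℝ} (ha : 0 < a) (ha' : a < 1)
    (hsum : Summable fun n : ℕ ↦ (1 / (n + a : ℂ) - 1 / (n + 1 - a : ℂ))) :
    ∑' n : ℕ, (1 / (n + a : ℂ) - 1 / (n + 1 - a : ℂ)) = π * Complex.cot (π * a) := by
  have hz : (a : ℂ) ∈ Complex.integerComplement := by
    rintro ⟨n, hn⟩
    have hn' : (n : ℝ) = a := by exact_mod_cast hn
    have h0 : (0 : ℝ) < n := hn' ▸ ha
    have h1 : (n : ℝ) < 1 := hn' ▸ ha'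
    norm_cast at h0 h1
    lia
  have hcot := tendsto_logDeriv_euler_cot_sub hz
  have hlim : Tendsto (fun n : ℕ ↦ (1 : ℂ) / (n + a)) atTop (𝓝 0) := by
    have : Tendsto (fun n : ℕ ↦ (1 : ℝ) / (n + a)) atTop (𝓝 0) :=
      tendsto_const_nhds.div_atTop
        (tendsto_atTop_add_const_right _ _ tendsto_natCast_atTop_atTop)
    simpa [Function.comp_def] using (Complex.continuous_ofReal.tendsto 0).comp this
  refine tendsto_nhds_unique hsum.hasSum.tendsto_sum_nat ?_
  have hpartial : ∀ n : ℕ,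
      ∑ j ∈ Finset.range n, (1 / (j + a : ℂ) - 1 / (j + 1 - a : ℂ)) =
        ∑ j ∈ Finset.range n, cotTerm a j + 1 / a - 1 / (n + a) := by
    intro n
    induction n with
    | zero => simp
    | succ n ih =>
      rw [Finset.sum_range_succ, Finset.sum_range_succ, ih, cotTerm,
        ← neg_sub ((n : ℂ) + 1) (a : ℂ), one_div_neg_eq_neg_one_div]
      push_cast
      rw [add_comm (a : ℂ) ((n : ℂ) + 1)]
      ring
  simp_rw [hpartial]
  simpa using (hcot.add_const (1 / (a : ℂ))).sub hlim

lemma hurwitzZetaOdd_one {a : ℝ} (ha : 0 < a) (ha' : a < 1) :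
    HurwitzZeta.hurwitzZetaOdd a 1 = π / 2 * Complex.cot (π * a) := by
  have hpos : ∀ n : ℕ, 0 < (n : ℝ) + a := fun n ↦ by positivity
  have hpos' : ∀ n : ℕ, 0 < (n : ℝ) + 1 - a := fun n ↦ by
    have : (0 : ℝ) ≤ n := n.cast_nonneg
    linarith
  let F : ℝ → ℕ → ℝ := fun s n ↦ ((n + a) ^ (-s) - (n + 1 - a) ^ (-s))
  have hbound : ∀ s : ℝ, 1 ≤ s → s ≤ 2 → ∀ n : ℕ, ‖F s (n + 1)‖ ≤ 2 / ((n : ℝ) + 1) ^ 2 := by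
    intro s hs hs' n
    have hn : (1 : ℝ) ≤ n + 1 := by simp
    simp only [F, Real.norm_eq_abs]
    push_cast
    rcases le_total a (1 / 2) with h | h
    · exact rpow_neg_sub_rpow_neg_le hn (by linarith) (by linarith) (by linarith) hs hs'
    · rw [abs_sub_comm]
      exact rpow_neg_sub_rpow_neg_le hn (by linarith) (by linarith) (by linarith) hs hs'
  have hsumm : Summable fun n : ℕ ↦ 2 / ((n : ℝ) + 1) ^ 2 := by
    have := (summable_nat_add_iff 1).2 (Real.summable_one_div_nat_pow.2 one_lt_two)
    simpa [div_eq_mul_inv] using this.mul_left 2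
  have hF : ∀ s : ℝ, 1 ≤ s → s ≤ 2 → Summable (F s) := fun s hs hs' ↦
    (summable_nat_add_iff 1).1 (Summable.of_norm_bounded hsumm (hbound s hs hs'))
  have hev : ∀ᶠ s : ℝ in 𝓝[>] 1, 1 < s ∧ s ≤ 2 := by
    filter_upwards [Ioc_mem_nhdsGT (one_lt_two : (1 : ℝ) < 2)] with s hs using hs
  have hcont : ∀ n, Tendsto (fun s ↦ F s n) (𝓝[>] 1) (𝓝 (F 1 n)) := by
    intro n
    have : Continuous fun s ↦ F s n :=
      (continuous_const.rpow continuous_neg fun _ ↦ .inl (hpos n).ne').sub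
        (continuous_const.rpow continuous_neg fun _ ↦ .inl (hpos' n).ne')
    exact this.continuousAt.tendsto.mono_left nhdsWithin_le_nhds
  have htsum : Tendsto (fun s ↦ ∑' n, F s n) (𝓝[>] 1) (𝓝 (∑' n, F 1 n)) := by
    have htail : Tendsto (fun s ↦ ∑' n, F s (n + 1)) (𝓝[>] 1) (𝓝 (∑' n, F 1 (n + 1))) :=
      tendsto_tsum_of_dominated_convergence hsumm (fun n ↦ hcont (n + 1))
        (hev.mono fun s hs ↦ hbound s hs.1.le hs.2)
    rw [(hF 1 le_rfl one_le_two).tsum_eq_zero_add]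
    refine ((hcont 0).add htail).congr' (hev.mono fun s hs ↦ ?_)
    exact (hF s hs.1.le hs.2).tsum_eq_zero_add.symm
  have hzeta : Tendsto (fun s : ℝ ↦ HurwitzZeta.hurwitzZetaOdd a s) (𝓝[>] 1)
      (𝓝 (HurwitzZeta.hurwitzZetaOdd a 1)) := by
    have := ((HurwitzZeta.differentiable_hurwitzZetaOdd (a : UnitAddCircle)).continuous.comp
      Complex.continuous_ofReal).tendsto 1
    simpa [Function.comp_def] using this.mono_left nhdsWithin_le_nhds
  have hval : ∀ s : ℝ, 1 < s →
      HurwitzZeta.hurwitzZetaOdd a s = ((∑' n, F s n : ℝ) : ℂ) / 2 := by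
    intro s hs
    rw [← (HurwitzZeta.hasSum_nat_hurwitzZetaOdd_of_mem_Icc (a := a) ⟨ha.le, ha'.le⟩
      (s := s) (by simpa using hs)).tsum_eq, tsum_div_const, Complex.ofReal_tsum]
    congr 2 with n
    simp only [F]
    rw [rpow_neg (hpos n).le, rpow_neg (hpos' n).le]
    push_cast [Complex.ofReal_cpow (hpos n).le, Complex.ofReal_cpow (hpos' n).le]
    simp
  have hF1 : ∀ n : ℕ, (F 1 n : ℂ) = 1 / (n + a : ℂ) - 1 / (n + 1 - a : ℂ) := by
    intro n
    simp [F, rpow_neg_one]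
  have hcot := tsum_one_div_sub_one_div_eq_cot ha ha' (by
    simpa only [hF1] using (Complex.hasSum_ofReal.2 (hF 1 le_rfl one_le_two).hasSum).summable)
  refine tendsto_nhds_unique hzeta ?_
  have h2 := ((Complex.continuous_ofReal.tendsto _).comp htsum).div_const (2 : ℂ)
  rw [Complex.ofReal_tsum] at h2
  simp_rw [hF1] at h2
  rw [hcot] at h2
  rw [div_mul_eq_mul_div]
  exact h2.congr' (hev.mono fun s hs ↦ (hval s hs.1).symm)

lemma add_one_div_sub_one_eq_sum {K : Type*} [Field K] [CharZero K] {N : ℕ} (hN : N ≠ 0) {x : K}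
    (hx : x ≠ 1) (hxN : x ^ N = 1) :
    (x + 1) / (x - 1) = 1 + 2 / N * ∑ m ∈ Finset.range N, (m : K) * x ^ m := by
  have hsum : ∀ n : ℕ, (∑ m ∈ Finset.range n, (m : K) * x ^ m) * (x - 1) =
      n * x ^ n - x * ∑ m ∈ Finset.range n, x ^ m := by
    intro n
    induction n with
    | zero => simp
    | succ n ih =>
      rw [Finset.sum_range_succ, Finset.sum_range_succ, add_mul, ih]
      push_cast
      ring
  have hx1 : x - 1 ≠ 0 := sub_ne_zero.2 hx
  have hgeom : ∑ m ∈ Finset.range N, x ^ m = 0 := by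
    rw [geom_sum_eq hx, hxN, sub_self, zero_div]
  have hN' : (N : K) ≠ 0 := Nat.cast_ne_zero.2 hN
  have key := hsum N
  rw [hgeom, hxN, mul_zero, sub_zero, mul_one] at key
  rw [eq_div_of_mul_eq hx1 key]
  field_simp
  ring

lemma sum_add_one_div_sub_one_eq_zero_of_isPrimitiveRoot {N : ℕ} (hN : N ≠ 0) {ζ ξ : ℂ}
    (hζ : IsPrimitiveRoot ζ N) (hξ : IsPrimitiveRoot ξ N) (S : Finset ℕ)
    (hS : ∀ k ∈ S, 0 < k ∧ k < N) (a : ℕ → ℚ)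
    (h : ∑ k ∈ S, (a k : ℂ) * ((ζ ^ k + 1) / (ζ ^ k - 1)) = 0) :
    ∑ k ∈ S, (a k : ℂ) * ((ξ ^ k + 1) / (ξ ^ k - 1)) = 0 := by
  let Q : Polynomial ℚ := ∑ k ∈ S, Polynomial.C (a k) *
    (1 + Polynomial.C (2 / N : ℚ) * ∑ m ∈ Finset.range N,
      (m : Polynomial ℚ) * (Polynomial.X ^ k) ^ m)
  have hQ : ∀ z : ℂ, IsPrimitiveRoot z N →
      Polynomial.aeval z Q = ∑ k ∈ S, (a k : ℂ) * ((z ^ k + 1) / (z ^ k - 1)) := by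
    intro z hz
    simp only [Q, map_sum, map_mul, map_add, map_one, map_pow, map_natCast, Polynomial.aeval_C,
      Polynomial.aeval_X, eq_ratCast]
    refine Finset.sum_congr rfl fun k hk ↦ ?_
    rw [add_one_div_sub_one_eq_sum hN (hz.pow_ne_one_of_pos_of_lt (hS k hk).1.ne' (hS k hk).2)
      (by rw [← pow_mul, mul_comm, pow_mul, hz.pow_eq_one, one_pow])]
    push_cast
    rfl
  have hpos := Nat.pos_of_ne_zero hN
  have hdvd : minpoly ℚ ξ ∣ Q := by
    rw [← Polynomial.cyclotomic_eq_minpoly_rat hξ hpos,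
      Polynomial.cyclotomic_eq_minpoly_rat hζ hpos]
    exact minpoly.dvd ℚ ζ (by rw [hQ ζ hζ, h])
  rw [← hQ ξ hξ]
  exact Polynomial.aeval_eq_zero_of_dvd_aeval_eq_zero hdvd (minpoly.aeval ℚ ξ)

lemma stdAddChar_natCast {N : ℕ} [NeZero N] (k : ℕ) :
    ZMod.stdAddChar (k : ZMod N) = Complex.exp (2 * π * Complex.I * (k / N)) := by
  have := ZMod.stdAddChar_coe (N := N) k
  push_cast at this
  rw [this, mul_div_assoc]

lemma cot_pi_mul_div_eq {N : ℕ} [NeZero N] (k : ℕ) :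
    Complex.cot (π * (k / N)) = Complex.I *
      ((ZMod.stdAddChar (k : ZMod N) + 1) / (ZMod.stdAddChar (k : ZMod N) - 1)) := by
  rw [Complex.cot_pi_eq_exp_ratio, stdAddChar_natCast, ← neg_sub (Complex.exp _) 1, mul_neg,
    ← neg_mul, ← mul_div_assoc, ← Complex.inv_I, div_mul_eq_div_div]
  simp [div_eq_mul_inv]
  ring

lemma isPrimitiveRoot_stdAddChar {N : ℕ} [NeZero N] {u : ZMod N} (hu : IsUnit u) :
    IsPrimitiveRoot (ZMod.stdAddChar u) N := by
  have h1 : IsPrimitiveRoot (ZMod.stdAddChar (1 : ZMod N)) N := by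
    have := stdAddChar_natCast (N := N) 1
    rw [Nat.cast_one] at this
    rw [this, Nat.cast_one, mul_one_div]
    exact Complex.isPrimitiveRoot_exp N (NeZero.ne N)
  have hpow : ZMod.stdAddChar u = ZMod.stdAddChar (1 : ZMod N) ^ u.val := by
    rw [← AddChar.map_nsmul_eq_pow, nsmul_one, ZMod.natCast_zmod_val]
  rw [hpow]
  refine h1.pow_of_coprime _ ?_
  rwa [← ZMod.isUnit_iff_coprime, ZMod.natCast_zmod_val]

lemma sum_odd_character_mul_ne_zero {N : ℕ} [NeZero N] {χ : DirichletCharacter ℂ N}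
    (hχ : χ.Odd) :
    ∑ j : ZMod N, χ j * ((ZMod.stdAddChar j + 1) / (ZMod.stdAddChar j - 1)) ≠ 0 := by
  have hχ1 : χ ≠ 1 := by
    rintro rfl
    have h : (1 : DirichletCharacter ℂ N) (-1) = -1 := hχ
    rw [MulChar.one_apply (isUnit_one.neg)] at h
    norm_num at h
  have hL := DirichletCharacter.LFunction_apply_one_ne_zero hχ1
  contrapose! hL
  have hodd : Function.Odd (χ : ZMod N → ℂ) := fun x ↦ DirichletCharacter.Odd.eval_neg χ x hχ
  rw [DirichletCharacter.LFunction, ZMod.LFunction_def_odd hodd]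
  refine mul_eq_zero_of_right _ ?_
  have hterm : ∀ j : ZMod N, χ j * HurwitzZeta.hurwitzZetaOdd (ZMod.toAddCircle j) 1 =
      π / 2 * Complex.I * (χ j * ((ZMod.stdAddChar j + 1) / (ZMod.stdAddChar j - 1))) := by
    intro j
    rcases eq_or_ne j 0 with rfl | hj
    · have := hodd 0
      rw [neg_zero, self_eq_neg] at this
      simp [this]
    · have hN : (0 : ℝ) < N := Nat.cast_pos.2 (NeZero.pos N)
      have hj0 : (0 : ℝ) < j.val := Nat.cast_pos.2 (ZMod.val_pos.2 hj)
      have hjN : (j.val : ℝ) < N := Nat.cast_lt.2 (ZMod.val_lt j)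
      have hcot := cot_pi_mul_div_eq (N := N) j.val
      rw [ZMod.natCast_zmod_val] at hcot
      rw [ZMod.toAddCircle_apply, hurwitzZetaOdd_one (by positivity) ((div_lt_one hN).2 hjN)]
      push_cast
      rw [hcot]
      ring
  simp_rw [hterm, ← Finset.mul_sum, hL, mul_zero]

lemma eq_zero_of_sum_add_one_div_sub_one_eq_zero {N : ℕ} (hN : 3 ≤ N) [NeZero N] (S : Finset ℕ)
    (hS : ∀ k ∈ S, 1 ≤ k ∧ 2 * k < N ∧ Nat.gcd k N = 1) (a : ℕ → ℚ)
    (h : ∑ k ∈ S, (a k : ℂ) * ((ZMod.stdAddChar (k : ZMod N) + 1) /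
      (ZMod.stdAddChar (k : ZMod N) - 1)) = 0) {l : ℕ} (hl : l ∈ S) : a l = 0 := by
  let C : ZMod N → ℂ := fun j ↦ (ZMod.stdAddChar j + 1) / (ZMod.stdAddChar j - 1)
  have hunit : ∀ k ∈ S, IsUnit (k : ZMod N) := fun k hk ↦
    (ZMod.isUnit_iff_coprime k N).2 (hS k hk).2.2
  have hpow : ∀ (u : ZMod N) (k : ℕ), ZMod.stdAddChar (u * (k : ZMod N)) = ZMod.stdAddChar u ^ k := by
    intro u k
    rw [← AddChar.map_nsmul_eq_pow, nsmul_eq_mul, mul_comm]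
  have hgal : ∀ u : ZMod N, IsUnit u → ∑ k ∈ S, (a k : ℂ) * C (u * k) = 0 := by
    intro u hu
    simp only [C, hpow]
    refine sum_add_one_div_sub_one_eq_zero_of_isPrimitiveRoot (by lia)
      (isPrimitiveRoot_stdAddChar isUnit_one) (isPrimitiveRoot_stdAddChar hu) S
      (fun k hk ↦ by have := hS k hk; lia) a ?_
    simpa only [← hpow, one_mul] using h
  have htwist : ∀ χ : DirichletCharacter ℂ N,
      (1 - χ (-1)) * ∑ k ∈ S, (a k : ℂ) * χ (k : ZMod N)⁻¹ = 0 := by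
    intro χ
    rcases χ.even_or_odd with hχ | hχ
    · rw [show χ (-1) = 1 from hχ, sub_self, zero_mul]
    · refine mul_eq_zero_of_right _ ?_
      refine (mul_eq_zero.1 ?_).resolve_right (sum_odd_character_mul_ne_zero hχ)
      calc (∑ k ∈ S, (a k : ℂ) * χ (k : ZMod N)⁻¹) * ∑ j : ZMod N, χ j * C j
          = ∑ k ∈ S, ∑ u : ZMod N, χ u * ((a k : ℂ) * C (u * k)) := by
            rw [Finset.sum_mul]
            refine Finset.sum_congr rfl fun k hk ↦ ?_
            rw [Finset.mul_sum]
            refine (Fintype.sum_equiv (Units.mulRight (hunit k hk).unit) _ _ fun u ↦ ?_).symm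
            have hinv : χ (k : ZMod N)⁻¹ * χ (k : ZMod N) = 1 := by
              rw [← map_mul, ZMod.inv_mul_of_unit _ (hunit k hk), map_one]
            simp only [Units.mulRight_apply, IsUnit.unit_spec, map_mul]
            linear_combination (-(χ u) * a k * C (u * k)) * hinv
        _ = ∑ u : ZMod N, χ u * ∑ k ∈ S, (a k : ℂ) * C (u * k) := by
            rw [Finset.sum_comm]
            simp only [Finset.mul_sum]
        _ = 0 := Finset.sum_eq_zero fun u _ ↦ by
            by_cases hu : IsUnit u
            · rw [hgal u hu, mul_zero]
            · rw [MulChar.map_nonunit χ hu, zero_mul]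
  have hcast : ∀ k ∈ S, (k : ZMod N) = l ↔ k = l := by
    intro k hk
    have h1 := hS k hk
    have h2 := hS l hl
    rw [ZMod.natCast_eq_natCast_iff', Nat.mod_eq_of_lt (by lia), Nat.mod_eq_of_lt (by lia)]
  have hneg : ∀ k ∈ S, (k : ZMod N) ≠ -l := by
    intro k hk hkl
    have h1 := hS k hk
    have h2 := hS l hl
    have h0 : ((k + l : ℕ) : ZMod N) = 0 := by
      push_cast
      rw [hkl, neg_add_cancel]
    rw [ZMod.natCast_eq_zero_iff] at h0
    have := Nat.le_of_dvd (by lia) h0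
    lia
  have hsum : ∑ χ : DirichletCharacter ℂ N,
      χ l * ((1 - χ (-1)) * ∑ k ∈ S, (a k : ℂ) * χ (k : ZMod N)⁻¹) = a l * N.totient := by
    calc _ = ∑ χ : DirichletCharacter ℂ N, ∑ k ∈ S,
          (a k : ℂ) * (χ (k : ZMod N)⁻¹ * χ l - χ (k : ZMod N)⁻¹ * χ (-l)) := by
          refine Finset.sum_congr rfl fun χ _ ↦ ?_
          rw [Finset.mul_sum, Finset.mul_sum]
          refine Finset.sum_congr rfl fun k _ ↦ ?_
          rw [← neg_one_mul (l : ZMod N), map_mul]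
          ring
      _ = ∑ k ∈ S, if k = l then (a l : ℂ) * N.totient else 0 := by
          rw [Finset.sum_comm]
          refine Finset.sum_congr rfl fun k hk ↦ ?_
          rw [← Finset.mul_sum, Finset.sum_sub_distrib,
            DirichletCharacter.sum_char_inv_mul_char_eq ℂ (hunit k hk),
            DirichletCharacter.sum_char_inv_mul_char_eq ℂ (hunit k hk), if_neg (hneg k hk),
            sub_zero]
          simp only [hcast k hk]
          split_ifs with hkl
          · rw [hkl]
          · rw [mul_zero]
      _ = _ := by rw [Finset.sum_ite_eq' S l, if_pos hl]
  simp only [htwist, mul_zero, Finset.sum_const_zero] at hsum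
  have htot : (N.totient : ℂ) ≠ 0 := Nat.cast_ne_zero.2 (Nat.totient_pos.2 (by lia)).ne'
  exact_mod_cast (mul_eq_zero.1 hsum.symm).resolve_right htot

lemma ofReal_inv_tan_eq {N : ℕ} [NeZero N] (k : ℕ) :
    (((tan (k * π / N))⁻¹ : ℝ) : ℂ) = Complex.I *
      ((ZMod.stdAddChar (k : ZMod N) + 1) / (ZMod.stdAddChar (k : ZMod N) - 1)) := by
  rw [← cot_pi_mul_div_eq, Complex.cot_eq_cos_div_sin]
  push_cast
  rw [Complex.tan_eq_sin_div_cos, inv_div]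
  ring_nf

/-- The real numbers `x` such that `I * x` lies in the field `K`, as a `ℚ`-subspace of `ℝ`. -/
noncomputable def imaginaryCoords (K : IntermediateField ℚ ℂ) : Submodule ℚ ℝ :=
  (Subalgebra.toSubmodule K.toSubalgebra).comap
    (LinearMap.mulLeft ℚ Complex.I ∘ₗ Complex.ofRealAm.toLinearMap.restrictScalars ℚ)

lemma mem_imaginaryCoords {K : IntermediateField ℚ ℂ} {x : ℝ} :
    x ∈ imaginaryCoords K ↔ Complex.I * x ∈ K := Iff.rfl

instance finite_imaginaryCoords (K : IntermediateField ℚ ℂ) [FiniteDimensional ℚ K] :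
    FiniteDimensional ℚ (imaginaryCoords K) := by
  let f : imaginaryCoords K →ₗ[ℚ] K :=
    { toFun := fun x ↦ ⟨Complex.I * (x : ℝ), x.2⟩
      map_add' := fun x y ↦ Subtype.ext (by simp [mul_add])
      map_smul' := fun c x ↦ Subtype.ext (by simp [Rat.smul_def]; ring) }
  refine FiniteDimensional.of_injective f fun x y hxy ↦ Subtype.ext ?_
  simpa [f] using congrArg Subtype.val hxy

lemma two_mul_finrank_imaginaryCoords_le (K : IntermediateField ℚ ℂ) [FiniteDimensional ℚ K]
    {w : ℝ} (hw : w ∈ imaginaryCoords K) (hw0 : w ≠ 0) :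
    2 * Module.finrank ℚ (imaginaryCoords K) ≤ Module.finrank ℚ K := by
  let f : (imaginaryCoords K × imaginaryCoords K) →ₗ[ℚ] K :=
    { toFun := fun p ↦ ⟨Complex.I * (p.1 : ℝ) + Complex.I * (p.2 : ℝ) * (Complex.I * w),
        add_mem p.1.2 (mul_mem p.2.2 hw)⟩
      map_add' := fun x y ↦ Subtype.ext (by simp; ring)
      map_smul' := fun c x ↦ Subtype.ext (by simp [Rat.smul_def]; ring) }
  have hf : Function.Injective f := by
    rw [← LinearMap.ker_eq_bot, LinearMap.ker_eq_bot']
    intro p hp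
    have hp' : Complex.I * (p.1 : ℝ) + Complex.I * (p.2 : ℝ) * (Complex.I * w) = 0 :=
      congrArg Subtype.val hp
    have him := congrArg Complex.im hp'
    have hre := congrArg Complex.re hp'
    simp at him hre
    exact Prod.ext him (hre.resolve_right hw0)
  have := LinearMap.finrank_le_finrank_of_injective hf
  rwa [Module.finrank_prod, ← two_mul] at this

lemma card_coprime_lt_half {N : ℕ} (hN : 3 ≤ N) :
    (Finset.filter (fun k => 1 ≤ k ∧ 2 * k < N ∧ Nat.gcd k N = 1) (Finset.range N)).card =
      N.totient / 2 := by
  have hupper : (Finset.filter (fun k => 1 ≤ k ∧ 2 * k < N ∧ Nat.gcd k N = 1)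
      (Finset.range N)).card =
      (Finset.filter (fun k => N < 2 * k ∧ Nat.gcd k N = 1) (Finset.range N)).card := by
    refine Finset.card_bij' (fun k _ ↦ N - k) (fun k _ ↦ N - k) ?_ ?_ ?_ ?_
    · intro k hk
      simp only [Finset.mem_filter, Finset.mem_range] at hk ⊢
      refine ⟨by lia, by lia, ?_⟩
      exact (Nat.coprime_self_sub_left hk.1.le).2 hk.2.2.2
    · intro k hk
      simp only [Finset.mem_filter, Finset.mem_range] at hk ⊢
      refine ⟨by lia, by lia, by lia, ?_⟩
      exact (Nat.coprime_self_sub_left hk.1.le).2 hk.2.2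
    · intro k hk
      simp only [Finset.mem_filter, Finset.mem_range] at hk
      lia
    · intro k hk
      simp only [Finset.mem_filter, Finset.mem_range] at hk
      lia
  have htot : N.totient = (Finset.filter (fun k => 1 ≤ k ∧ 2 * k < N ∧ Nat.gcd k N = 1)
      (Finset.range N)).card +
      (Finset.filter (fun k => N < 2 * k ∧ Nat.gcd k N = 1) (Finset.range N)).card := by
    rw [Nat.totient_eq_card_coprime, ← Finset.card_union_of_disjoint]
    · congr 1
      ext k
      simp only [Finset.mem_filter, Finset.mem_range, Finset.mem_union, Nat.Coprime,
        Nat.gcd_comm N k]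
      constructor
      · rintro ⟨hk, hc⟩
        have h0 : k ≠ 0 := by
          rintro rfl
          rw [Nat.gcd_zero_left] at hc
          lia
        have hhalf : 2 * k ≠ N := by
          rintro rfl
          rw [Nat.gcd_eq_left (Dvd.intro_left 2 rfl)] at hc
          lia
        lia
      · rintro (⟨h1, h2, h3, h4⟩ | ⟨h1, h2, h3⟩)
        · exact ⟨h1, h4⟩
        · exact ⟨h1, h3⟩
    · rw [Finset.disjoint_left]
      intro k hk hk'
      simp only [Finset.mem_filter] at hk hk'
      lia
  lia

lemma finrank_adjoin_stdAddChar_one (N : ℕ) [NeZero N] :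
    Module.finrank ℚ (IntermediateField.adjoin ℚ {(ZMod.stdAddChar (1 : ZMod N) : ℂ)}) =
      N.totient := by
  have hζ := isPrimitiveRoot_stdAddChar (N := N) isUnit_one
  rw [IntermediateField.adjoin.finrank ((hζ.isIntegral (NeZero.pos N)).tower_top),
    ← Polynomial.cyclotomic_eq_minpoly_rat hζ (NeZero.pos N), Polynomial.natDegree_cyclotomic]

lemma eq_zero_of_sum_mul_inv_tan_eq_zero {N : ℕ} (hN : 3 ≤ N) (a : ℕ → ℚ) (S : Finset ℕ)
    (hS : ∀ k ∈ S, 1 ≤ k ∧ 2 * k < N ∧ Nat.gcd k N = 1)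
    (h : ∑ k ∈ S, (a k : ℝ) * (tan (k * π / N))⁻¹ = 0) {l : ℕ} (hl : l ∈ S) : a l = 0 := by
  have : NeZero N := ⟨by lia⟩
  refine eq_zero_of_sum_add_one_div_sub_one_eq_zero hN S hS a ?_ hl
  have h' := congrArg ((↑) : ℝ → ℂ) h
  simp only [Complex.ofReal_sum, Complex.ofReal_mul, ofReal_inv_tan_eq, Complex.ofReal_zero,
    mul_left_comm _ Complex.I, ← Finset.mul_sum, Complex.ofReal_ratCast] at h'
  exact (mul_eq_zero.1 h').resolve_left Complex.I_ne_zero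

lemma tan_natCast_mul_pi_div_pos {N k : ℕ} (hk : 1 ≤ k) (hkN : 2 * k < N) :
    0 < tan (k * π / N) := by
  have hN : (0 : ℝ) < N := Nat.cast_pos.2 (by lia)
  have hk' : (0 : ℝ) < k := Nat.cast_pos.2 hk
  have hkN' : 2 * (k : ℝ) < N := by exact_mod_cast hkN
  refine tan_pos_of_pos_of_lt_pi_div_two (by positivity) ?_
  rw [div_lt_div_iff₀ hN two_pos]
  nlinarith [pi_pos]

lemma inv_tan_mem_span {N : ℕ} (hN : 3 ≤ N) (j : ℕ) :
    (tan (j * π / N))⁻¹ ∈ Submodule.span ℚ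
      {x : ℝ | ∃ k : ℕ, 1 ≤ k ∧ 2 * k < N ∧ Nat.gcd k N = 1 ∧ x = (tan (k * π / N))⁻¹} := by
  have : NeZero N := ⟨by lia⟩
  let ζ : ℂ := ZMod.stdAddChar (1 : ZMod N)
  let K := IntermediateField.adjoin ℚ {ζ}
  have hfin : FiniteDimensional ℚ K := IntermediateField.adjoin.finiteDimensional
    ((isPrimitiveRoot_stdAddChar isUnit_one).isIntegral (NeZero.pos N)).tower_top
  have hmem : ∀ k : ℕ, (tan (k * π / N))⁻¹ ∈ imaginaryCoords K := by
    intro k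
    have hpow : ZMod.stdAddChar (k : ZMod N) = ζ ^ k := by
      rw [← AddChar.map_nsmul_eq_pow, nsmul_one]
    have hζ : ζ ^ k ∈ K := pow_mem (IntermediateField.mem_adjoin_simple_self ℚ ζ) k
    rw [mem_imaginaryCoords, ofReal_inv_tan_eq, hpow, ← mul_assoc, Complex.I_mul_I, neg_one_mul]
    exact neg_mem (div_mem (add_mem hζ (one_mem K)) (sub_mem hζ (one_mem K)))
  let S := Finset.filter (fun k => 1 ≤ k ∧ 2 * k < N ∧ Nat.gcd k N = 1) (Finset.range N)
  have hS : ∀ k ∈ S, 1 ≤ k ∧ 2 * k < N ∧ Nat.gcd k N = 1 := fun k hk ↦ (Finset.mem_filter.1 hk).2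
  have hind : LinearIndependent ℚ (fun k : S ↦ (tan ((k : ℕ) * π / N))⁻¹) := by
    refine linearIndepOn_finset_iff (v := fun k : ℕ ↦ (tan (k * π / N))⁻¹).2 fun a ha k hk ↦ ?_
    simp only [Rat.smul_def] at ha
    exact eq_zero_of_sum_mul_inv_tan_eq_zero hN a S hS ha hk
  have hcard : Module.finrank ℚ (Submodule.span ℚ
      (Set.range fun k : S ↦ (tan ((k : ℕ) * π / N))⁻¹)) = N.totient / 2 := by
    rw [finrank_span_eq_card hind, Fintype.card_coe, card_coprime_lt_half hN]
  have hle : Submodule.span ℚ (Set.range fun k : S ↦ (tan ((k : ℕ) * π / N))⁻¹) ≤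
      imaginaryCoords K :=
    Submodule.span_le.2 (by rintro _ ⟨k, rfl⟩; exact hmem k)
  have hdim := two_mul_finrank_imaginaryCoords_le K (hmem 1)
    (inv_ne_zero (tan_natCast_mul_pi_div_pos le_rfl (by lia)).ne')
  rw [finrank_adjoin_stdAddChar_one] at hdim
  have heq := Submodule.eq_of_le_of_finrank_le hle (by lia)
  have hj := hmem j
  rw [← heq] at hj
  refine Submodule.span_mono ?_ hj
  rintro _ ⟨k, rfl⟩
  obtain ⟨h1, h2, h3⟩ := hS k k.2
  exact ⟨k, h1, h2, h3, rfl⟩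

/-- Complexity of scales: for `N ≥ 3`, (i) the primitive scales
`tan(π/N)/tan(kπ/N)` with `1 ≤ k < N/2`, `gcd(k, N) = 1` are linearly
independent over `ℚ`; (ii) every scale `tan(π/N)/tan(jπ/N)` with
`1 ≤ j < N/2` lies in their `ℚ`-linear span; and there are exactly `φ(N)/2`
primitive scales. -/
theorem primitive_scales_basis
    (N : ℕ) (hN : 3 ≤ N) :
    (∀ a : ℕ → ℚ,
      (∑ k ∈ Finset.filter (fun k => 1 ≤ k ∧ 2 * k < N ∧ Nat.gcd k N = 1) (Finset.range N),
          (a k : ℝ) * (Real.tan (Real.pi / N) / Real.tan (k * Real.pi / N)) = 0) →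
        ∀ k : ℕ, 1 ≤ k → 2 * k < N → Nat.gcd k N = 1 → a k = 0) ∧
    (∀ j : ℕ, 1 ≤ j → 2 * j < N →
      Real.tan (Real.pi / N) / Real.tan (j * Real.pi / N) ∈
        Submodule.span ℚ
          {x : ℝ | ∃ k : ℕ, 1 ≤ k ∧ 2 * k < N ∧ Nat.gcd k N = 1 ∧
            x = Real.tan (Real.pi / N) / Real.tan (k * Real.pi / N)}) ∧
    (Finset.filter (fun k => 1 ≤ k ∧ 2 * k < N ∧ Nat.gcd k N = 1) (Finset.range N)).card =
      N.totient / 2 := by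
  refine ⟨fun a ha k hk hkN hcop ↦ ?_, fun j _ _ ↦ ?_, card_coprime_lt_half hN⟩
  · have htan : tan (π / N) ≠ 0 := by
      simpa using (tan_natCast_mul_pi_div_pos (N := N) (k := 1) le_rfl (by lia)).ne'
    refine eq_zero_of_sum_mul_inv_tan_eq_zero hN a _
      (fun l hl ↦ (Finset.mem_filter.1 hl).2) ?_
      (Finset.mem_filter.2 ⟨Finset.mem_range.2 (by lia : k < N), hk, hkN, hcop⟩)
    simp only [div_eq_mul_inv (tan (π / N)), mul_left_comm _ (tan (π / N)),
      ← Finset.mul_sum] at ha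
    exact (mul_eq_zero.1 ha).resolve_left htan
  · have h := Submodule.mem_map_of_mem (f := LinearMap.mulLeft ℚ (tan (π / N)))
      (inv_tan_mem_span hN j)
    rw [Submodule.map_span] at h
    rw [div_eq_mul_inv]
    refine Submodule.span_mono ?_ h
    rintro _ ⟨_, ⟨k, h1, h2, h3, rfl⟩, rfl⟩
    exact ⟨k, h1, h2, h3, (div_eq_mul_inv _ _).symm⟩
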